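/- arXiv:1410.3583 — 6 statements merged into one kernel-verified Lean document; each statement's English description precedes it below -/
import Mathlib

section
/- Let U_D be any unitary M×M complex matrix such that U_D · D · U_D† = d̂ is diagonal, and let 𝒰 be the N×N block-diagonal matrix with diagonal blocks U_D·P^(M) (rows/columns 1..M), the scalar 1 (row/column M+1), and U_D (rows/columns M+2..N), where P^(M) is the M×M exchange matrix. Then 𝒰 is unitary and 𝒰 · H̃ · 𝒰† = H(d, α, β, u), where d is the vector of diagonal entries of d̂, α = U_D · P^(M) · w and β = U_D · v. -/
open Matrix

/-- 1-based access to a vector indexed by `Fin M`: `get1 w n = w_{n}` for `1 ≤ n ≤ M`. -/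
def get1 {α : Type*} [Zero α] {M : ℕ} (w : Fin M → α) (n : ℕ) : α :=
  if h : n - 1 < M then w ⟨n - 1, h⟩ else 0

/-- The `M × M` discretized free kinetic-energy matrix `D` (complex entries):
`D_{i,i+1} = D_{i+1,i} = -1` (1-based indices), all other entries `0`. -/
def Dmat (M : ℕ) : Matrix (Fin M) (Fin M) ℂ :=
  Matrix.of fun i j => if (i : ℕ) + 1 = (j : ℕ) ∨ (j : ℕ) + 1 = (i : ℕ) then -1 else 0

/-- The `M × M` exchange (antidiagonal) matrix `P^(M)`. -/
def Pexch (M : ℕ) : Matrix (Fin M) (Fin M) ℂ :=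
  Matrix.of fun i j => if (i : ℕ) + 1 + ((j : ℕ) + 1) = M + 1 then 1 else 0

/-- The `N × N` PT-symmetric Hamiltonian `H̃` with `N = 2M+1`
(entries described with 1-based indices `a = i+1`, `b = j+1`). -/
def Htilde (M : ℕ) (u : ℝ) (w v : Fin M → ℂ) :
    Matrix (Fin (2 * M + 1)) (Fin (2 * M + 1)) ℂ :=
  Matrix.of fun i j =>
    if ((j : ℕ) + 1 = (i : ℕ) + 2 ∧ ((i : ℕ) + 1 ≤ M - 1 ∨ (M + 2 ≤ (i : ℕ) + 1 ∧ (i : ℕ) + 1 ≤ 2 * M))) ∨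
       ((i : ℕ) + 1 = (j : ℕ) + 2 ∧ ((j : ℕ) + 1 ≤ M - 1 ∨ (M + 2 ≤ (j : ℕ) + 1 ∧ (j : ℕ) + 1 ≤ 2 * M))) then -1
    else if (i : ℕ) + 1 ≤ M ∧ (j : ℕ) + 1 = M + 1 then get1 w ((i : ℕ) + 1)
    else if (i : ℕ) + 1 = M + 1 ∧ (j : ℕ) + 1 ≤ M then star (get1 v (M + 1 - ((j : ℕ) + 1)))
    else if (i : ℕ) + 1 = M + 1 ∧ (j : ℕ) + 1 = M + 1 then (u : ℂ)
    else if (i : ℕ) + 1 = M + 1 ∧ M + 2 ≤ (j : ℕ) + 1 then star (get1 w (2 * M + 2 - ((j : ℕ) + 1)))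
    else if M + 2 ≤ (i : ℕ) + 1 ∧ (j : ℕ) + 1 = M + 1 then get1 v ((i : ℕ) + 1 - (M + 1))
    else 0

/-- The arrowhead-type matrix `H(d, α, β, u)` of size `N = 2M+1`
(entries described with 1-based indices `a = i+1`, `b = j+1`). -/
def Hmat (M : ℕ) (d α β : Fin M → ℂ) (u : ℝ) :
    Matrix (Fin (2 * M + 1)) (Fin (2 * M + 1)) ℂ :=
  Matrix.of fun i j =>
    if (i : ℕ) + 1 ≤ M ∧ (j : ℕ) = (i : ℕ) then get1 d ((i : ℕ) + 1)
    else if M + 2 ≤ (i : ℕ) + 1 ∧ (j : ℕ) = (i : ℕ) then get1 d ((i : ℕ) + 1 - (M + 1))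
    else if (i : ℕ) + 1 = M + 1 ∧ (j : ℕ) + 1 = M + 1 then (u : ℂ)
    else if (i : ℕ) + 1 ≤ M ∧ (j : ℕ) + 1 = M + 1 then get1 α ((i : ℕ) + 1)
    else if (i : ℕ) + 1 = M + 1 ∧ (j : ℕ) + 1 ≤ M then star (get1 β ((j : ℕ) + 1))
    else if (i : ℕ) + 1 = M + 1 ∧ M + 2 ≤ (j : ℕ) + 1 then star (get1 α ((j : ℕ) + 1 - (M + 1)))
    else if M + 2 ≤ (i : ℕ) + 1 ∧ (j : ℕ) + 1 = M + 1 then get1 β ((i : ℕ) + 1 - (M + 1))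
    else 0

/-- The `N × N` block-diagonal matrix `𝒰` with diagonal blocks
`U_D · P^(M)`, the scalar `1`, and `U_D`. -/
noncomputable def Ublock (M : ℕ) (UD : Matrix (Fin M) (Fin M) ℂ) :
    Matrix (Fin (2 * M + 1)) (Fin (2 * M + 1)) ℂ :=
  Matrix.of fun i j =>
    if h : (i : ℕ) < M ∧ (j : ℕ) < M then (UD * Pexch M) ⟨(i : ℕ), h.1⟩ ⟨(j : ℕ), h.2⟩
    else if (i : ℕ) = M ∧ (j : ℕ) = M then 1
    else if h : M + 1 ≤ (i : ℕ) ∧ M + 1 ≤ (j : ℕ) then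
      UD ⟨(i : ℕ) - (M + 1), by have := i.isLt; omega⟩
         ⟨(j : ℕ) - (M + 1), by have := j.isLt; omega⟩
    else 0

/-- The splitting of the `2M+1` indices into the first `M`, the central one and the last `M`. -/
def blockEquiv (M : ℕ) : (Fin M ⊕ Fin 1) ⊕ Fin M ≃ Fin (2 * M + 1) :=
  ((finSumFinEquiv.sumCongr (Equiv.refl _)).trans finSumFinEquiv).trans (finCongr (by omega))

@[simp] theorem blockEquiv_left {M : ℕ} (i : Fin M) :
    (blockEquiv M (.inl (.inl i)) : ℕ) = i := by
  simp [blockEquiv]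

@[simp] theorem blockEquiv_center {M : ℕ} (i : Fin 1) :
    (blockEquiv M (.inl (.inr i)) : ℕ) = M := by
  simp [blockEquiv]

@[simp] theorem blockEquiv_right {M : ℕ} (i : Fin M) :
    (blockEquiv M (.inr i) : ℕ) = M + 1 + i := by
  simp [blockEquiv]

/-- The matrix with diagonal blocks `A`, `u`, `A`, central column `(a, u, b)` and
central row `(x, u, y)`. -/
def arrowhead {M : ℕ} (A : Matrix (Fin M) (Fin M) ℂ) (a b x y : Fin M → ℂ) (u : ℂ) :
    Matrix ((Fin M ⊕ Fin 1) ⊕ Fin M) ((Fin M ⊕ Fin 1) ⊕ Fin M) ℂ :=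
  fromBlocks (fromBlocks A (replicateCol (Fin 1) a) (replicateRow (Fin 1) x) (of fun _ _ => u))
    (fromRows 0 (replicateRow (Fin 1) y)) (fromCols 0 (replicateCol (Fin 1) b)) A

theorem get1_eq {α : Type*} [Zero α] {M : ℕ} (w : Fin M → α) {n : ℕ} (i : Fin M)
    (h : n - 1 = i) : get1 w n = w i := by
  simp [get1, h]

theorem Pexch_apply {M : ℕ} (i j : Fin M) : Pexch M i j = if j = i.rev then 1 else 0 := by
  simp only [Pexch, of_apply, Fin.ext_iff, Fin.val_rev]
  congr 1
  grind

theorem Pexch_mulVec {M : ℕ} (w : Fin M → ℂ) (i : Fin M) : (Pexch M *ᵥ w) i = w i.rev := by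
  simp [mulVec, dotProduct, Pexch_apply]

theorem Pexch_mul_apply {M : ℕ} (A : Matrix (Fin M) (Fin M) ℂ) (i j : Fin M) :
    (Pexch M * A) i j = A i.rev j := by
  simp [mul_apply, Pexch_apply]

theorem Pexch_mul_self (M : ℕ) : Pexch M * Pexch M = 1 := by
  ext i j
  simp [Pexch_mul_apply, Pexch_apply, one_apply, eq_comm]

theorem Pexch_conjTranspose (M : ℕ) : (Pexch M)ᴴ = Pexch M := by
  ext i j
  simp [Pexch, add_comm, add_left_comm, apply_ite]

theorem Pexch_mul_Dmat (M : ℕ) : Pexch M * Dmat M = Dmat M * Pexch M := by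
  have h : Dmat M * Pexch M = (Pexch M * (Dmat M)ᴴ)ᴴ := by
    simp [Pexch_conjTranspose]
  ext i j
  rw [h]
  simp only [conjTranspose_apply, Pexch_mul_apply, Dmat, of_apply, Fin.val_rev]
  split_ifs <;> first | simp; done | omega

theorem Ublock_submatrix (M : ℕ) (U : Matrix (Fin M) (Fin M) ℂ) :
    (Ublock M U).submatrix (blockEquiv M) (blockEquiv M) =
      fromBlocks (fromBlocks (U * Pexch M) 0 0 1) 0 0 U := by
  ext ((i | i) | i) ((j | j) | j) <;>
    simp [Ublock, one_apply, Fin.eq_zero] <;> (try split_ifs) <;> first | rfl | omega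

theorem Htilde_submatrix (M : ℕ) (u : ℝ) (w v : Fin M → ℂ) :
    (Htilde M u w v).submatrix (blockEquiv M) (blockEquiv M) =
      arrowhead (Dmat M) w v (star (Pexch M *ᵥ v)) (star (Pexch M *ᵥ w)) u := by
  ext ((i | i) | i) ((j | j) | j) <;>
    simp only [Htilde, arrowhead, submatrix_apply, of_apply, blockEquiv_left, blockEquiv_center,
      blockEquiv_right, fromBlocks_apply₁₁, fromBlocks_apply₁₂, fromBlocks_apply₂₁,
      fromBlocks_apply₂₂, fromRows_apply_inl, fromRows_apply_inr, fromCols_apply_inl,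
      fromCols_apply_inr, replicateCol_apply, replicateRow_apply, Matrix.zero_apply, Pi.star_apply,
      and_true, true_and,
      Pexch_mulVec, Dmat] <;>
    split_ifs <;> first
      | rfl
      | omega
      | exact get1_eq _ _ (by omega)
      | exact congrArg star (get1_eq _ _ (by rw [Fin.val_rev]; omega))

theorem Hmat_submatrix (M : ℕ) (d α β : Fin M → ℂ) (u : ℝ) :
    (Hmat M d α β u).submatrix (blockEquiv M) (blockEquiv M) =
      arrowhead (diagonal d) α β (star β) (star α) u := by
  ext ((i | i) | i) ((j | j) | j) <;>
    simp only [Hmat, arrowhead, submatrix_apply, of_apply, blockEquiv_left, blockEquiv_center,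
      blockEquiv_right, fromBlocks_apply₁₁, fromBlocks_apply₁₂, fromBlocks_apply₂₁,
      fromBlocks_apply₂₂, fromRows_apply_inl, fromRows_apply_inr, fromCols_apply_inl,
      fromCols_apply_inr, replicateCol_apply, replicateRow_apply, Matrix.zero_apply, Pi.star_apply,
      and_true, true_and,
      diagonal_apply, Fin.ext_iff] <;>
    split_ifs <;> first
      | rfl
      | omega
      | exact get1_eq _ _ (by omega)
      | exact congrArg star (get1_eq _ _ (by omega))

theorem blockDiag_conj_arrowhead {M : ℕ} (V U A : Matrix (Fin M) (Fin M) ℂ)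
    (a b x y : Fin M → ℂ) (u : ℂ) (h : V * A * Vᴴ = U * A * Uᴴ) :
    fromBlocks (fromBlocks V 0 0 (1 : Matrix (Fin 1) (Fin 1) ℂ)) 0 0 U * arrowhead A a b x y u *
        (fromBlocks (fromBlocks V 0 0 (1 : Matrix (Fin 1) (Fin 1) ℂ)) 0 0 U)ᴴ =
      arrowhead (V * A * Vᴴ) (V *ᵥ a) (U *ᵥ b) (x ᵥ* Vᴴ) (y ᵥ* Uᴴ) u := by
  simp only [arrowhead, fromBlocks_conjTranspose, fromBlocks_multiply, fromBlocks_mul_fromRows,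
    fromCols_mul_fromBlocks, fromRows_mul, mul_fromCols, conjTranspose_zero, conjTranspose_one,
    Matrix.zero_mul, Matrix.mul_zero, Matrix.one_mul, Matrix.mul_one, add_zero, zero_add,
    replicateCol_mulVec, replicateRow_vecMul, h]

/-- if `U_D` is unitary and diagonalizes `D` (i.e. `U_D · D · U_D†`
is diagonal), then the block matrix `𝒰` is unitary and `𝒰 · H̃ · 𝒰† = H(d, α, β, u)`,
where `d` is the diagonal of `U_D · D · U_D†`, `α = U_D · P^(M) · w`, `β = U_D · v`. -/
theorem statement5 (M : ℕ) (hM : 1 ≤ M) (u : ℝ) (w v : Fin M → ℂ)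
    (UD : Matrix (Fin M) (Fin M) ℂ)
    (hU1 : UD * UDᴴ = 1) (hU2 : UDᴴ * UD = 1)
    (hdiag : ∀ i j : Fin M, i ≠ j → (UD * Dmat M * UDᴴ) i j = 0)
    (d α β : Fin M → ℂ)
    (hd : ∀ i : Fin M, d i = (UD * Dmat M * UDᴴ) i i)
    (hα : α = (UD * Pexch M).mulVec w)
    (hβ : β = UD.mulVec v) :
    Ublock M UD * (Ublock M UD)ᴴ = 1 ∧ (Ublock M UD)ᴴ * Ublock M UD = 1 ∧
    Ublock M UD * Htilde M u w v * (Ublock M UD)ᴴ = Hmat M d α β u := by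
  have hV1 : UD * Pexch M * (UD * Pexch M)ᴴ = 1 := by
    rw [conjTranspose_mul, Pexch_conjTranspose, Matrix.mul_assoc, ← Matrix.mul_assoc (Pexch M),
      Pexch_mul_self, Matrix.one_mul, hU1]
  have hUnitary : Ublock M UD * (Ublock M UD)ᴴ = 1 := by
    apply (reindex (blockEquiv M).symm (blockEquiv M).symm).injective
    simp only [reindex_apply, Equiv.symm_symm]
    rw [← submatrix_mul_equiv _ _ _ (blockEquiv M), ← conjTranspose_submatrix, Ublock_submatrix]
    simp only [fromBlocks_conjTranspose, fromBlocks_multiply, hV1, hU1]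
    simp
  refine ⟨hUnitary, mul_eq_one_comm.mp hUnitary, ?_⟩
  have hD : UD * Dmat M * UDᴴ = diagonal d := by
    ext i j
    by_cases h : i = j
    · simp [h, hd]
    · simp [h, hdiag i j h]
  have hPD : UD * Pexch M * Dmat M * (UD * Pexch M)ᴴ = diagonal d := by
    rw [← hD, conjTranspose_mul, Pexch_conjTranspose, Matrix.mul_assoc UD, Pexch_mul_Dmat]
    simp only [Matrix.mul_assoc]
    rw [← Matrix.mul_assoc (Pexch M), Pexch_mul_self, Matrix.one_mul]
  apply (reindex (blockEquiv M).symm (blockEquiv M).symm).injective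
  simp only [reindex_apply, Equiv.symm_symm]
  rw [← submatrix_mul_equiv _ _ _ (blockEquiv M), ← submatrix_mul_equiv _ _ _ (blockEquiv M),
    ← conjTranspose_submatrix, Ublock_submatrix, Htilde_submatrix, Hmat_submatrix,
    blockDiag_conj_arrowhead _ _ _ _ _ _ _ _ (hPD.trans hD.symm), hPD, ← hα, ← hβ,
    ← star_mulVec, ← star_mulVec, mulVec_mulVec, mulVec_mulVec, ← hα, Matrix.mul_assoc UD,
    Pexch_mul_self, Matrix.mul_one, ← hβ]
end

section
/- Let H be an N×N complex matrix, let Ψ_1,…,Ψ_N be vectors in ℂ^N forming a basis of ℂ^N, and suppose H† Ψ_j = ε_j Ψ_j with ε_j ∈ ℝ for each j. Then for any positive reals κ_1,…,κ_N, the matrix Θ = Σ_{j=1}^{N} κ_j² · Ψ_j Ψ_j† (where Ψ_j Ψ_j† denotes the rank-one matrix with entries (Ψ_j)_a · conj((Ψ_j)_b)) is Hermitian, positive definite, and satisfies the quasi-Hermiticity (Hermitization) relation H† Θ = Θ H. -/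
open Matrix ComplexOrder

/-- A weighted sum of the rank-one matrices `v v†` as a product with a diagonal matrix. -/
lemma sum_smul_mul_star_eq {ι n : Type*} [Fintype ι] [DecidableEq ι] (d : ι → ℂ)
    (v : ι → n → ℂ) :
    ∑ j, d j • Matrix.of (fun a b => v j a * star (v j b)) =
      (Matrix.of v)ᵀ * diagonal d * (Matrix.of v)ᵀᴴ := by
  ext a b
  simp only [Matrix.sum_apply, Matrix.smul_apply, Matrix.of_apply, smul_eq_mul,
    Matrix.mul_apply (M := _ * _), Matrix.mul_diagonal, Matrix.transpose_apply,
    Matrix.conjTranspose_apply]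
  exact Finset.sum_congr rfl fun j _ => by ring

/-- The matrix whose columns are eigenvectors diagonalizes. -/
lemma mul_eigenvector_columns {ι n : Type*} [Fintype ι] [DecidableEq ι] [Fintype n]
    (A : Matrix n n ℂ) (v : ι → n → ℂ) (e : ι → ℂ) (h : ∀ j, A *ᵥ v j = e j • v j) :
    A * (Matrix.of v)ᵀ = (Matrix.of v)ᵀ * diagonal e := by
  ext a j
  rw [Matrix.mul_diagonal, Matrix.transpose_apply, Matrix.of_apply, mul_comm]
  exact congrFun (h j) a

/-- if `Ψ_1, …, Ψ_N` form a basis of `ℂ^N` consisting of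
eigenvectors of `H†` with real eigenvalues, then for any positive reals
`κ_1, …, κ_N` the matrix `Θ = Σ_j κ_j² · Ψ_j Ψ_j†` is Hermitian, positive
definite and satisfies the quasi-Hermiticity relation `H† Θ = Θ H`. -/
theorem statement11 (N : ℕ) (H : Matrix (Fin N) (Fin N) ℂ)
    (Ψ : Fin N → (Fin N → ℂ))
    (hind : LinearIndependent ℂ Ψ)
    (hspan : Submodule.span ℂ (Set.range Ψ) = ⊤)
    (ε : Fin N → ℝ)
    (heig : ∀ j, Hᴴ.mulVec (Ψ j) = (ε j : ℂ) • Ψ j)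
    (κ : Fin N → ℝ) (hκ : ∀ j, 0 < κ j)
    (Θ : Matrix (Fin N) (Fin N) ℂ)
    (hΘ : Θ = ∑ j : Fin N, ((κ j : ℂ) ^ 2) •
      Matrix.of (fun a b => Ψ j a * star (Ψ j b))) :
    Θ.IsHermitian ∧ Θ.PosDef ∧ Hᴴ * Θ = Θ * H := by
  have hB : IsUnit (Matrix.of Ψ)ᵀ :=
    (Matrix.isUnit_transpose _).2 (Matrix.linearIndependent_rows_iff_isUnit.1 hind)
  have hHB := mul_eigenvector_columns Hᴴ Ψ (fun j => (ε j : ℂ)) heig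
  rw [sum_smul_mul_star_eq (fun j => (κ j : ℂ) ^ 2)] at hΘ
  have hpos : Θ.PosDef := by
    rw [hΘ]
    refine Matrix.PosDef.mul_mul_conjTranspose_same (PosDef.diagonal fun j => ?_)
      (Matrix.vecMul_injective_iff_isUnit.2 hB)
    exact_mod_cast pow_pos (hκ j) 2
  refine ⟨hpos.isHermitian, hpos, ?_⟩
  have hBH : (Matrix.of Ψ)ᵀᴴ * H = diagonal (fun j => (ε j : ℂ)) * (Matrix.of Ψ)ᵀᴴ := by
    have h := congrArg conjTranspose hHB
    rw [conjTranspose_mul, conjTranspose_mul, conjTranspose_conjTranspose,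
      diagonal_conjTranspose] at h
    rw [h]
    congr 2
    ext j
    simp
  rw [hΘ, Matrix.mul_assoc _ _ H, hBH, ← Matrix.mul_assoc, ← Matrix.mul_assoc, hHB,
    ← Matrix.mul_assoc, Matrix.mul_assoc _ (diagonal _) (diagonal _),
    Matrix.mul_assoc _ (diagonal _) (diagonal _), diagonal_mul_diagonal, diagonal_mul_diagonal]
  simp only [mul_comm]
end

section
/- For every vector t = (t_1,…,t_N) ∈ ℝ^N there exists a unique real symmetric N×N matrix Θ whose first row equals t (i.e., Θ_{1,j} = t_j for all j) and which satisfies the Hermitization relation Ĥᵀ · Θ = Θ · Ĥ. In other words, the linear map sending a real symmetric solution Θ of Ĥᵀ Θ = Θ Ĥ to its first row is a bijection onto ℝ^N. -/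
open Matrix

/-- The maximally asymmetric PT-symmetric Hamiltonian `Ĥ` of size `N = 2M+1`,
with real parameters `u ∈ ℝ`, `w ∈ ℝ^M` (entries described with 1-based indices
`a = i+1`, `b = j+1`). -/
def Hhat (M : ℕ) (u : ℝ) (w : Fin M → ℝ) :
    Matrix (Fin (2 * M + 1)) (Fin (2 * M + 1)) ℝ :=
  Matrix.of fun i j =>
    if ((j : ℕ) + 1 = (i : ℕ) + 2 ∧ ((i : ℕ) + 1 ≤ M - 1 ∨ (M + 2 ≤ (i : ℕ) + 1 ∧ (i : ℕ) + 1 ≤ 2 * M))) ∨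
       ((i : ℕ) + 1 = (j : ℕ) + 2 ∧ ((j : ℕ) + 1 ≤ M - 1 ∨ (M + 2 ≤ (j : ℕ) + 1 ∧ (j : ℕ) + 1 ≤ 2 * M))) then -1
    else if (i : ℕ) + 1 ≤ M ∧ (j : ℕ) + 1 = M + 1 then get1 w ((i : ℕ) + 1)
    else if (i : ℕ) + 1 = M + 1 ∧ (j : ℕ) + 1 = M then -1
    else if (i : ℕ) + 1 = M + 1 ∧ (j : ℕ) + 1 = M + 1 then u
    else if (i : ℕ) + 1 = M + 1 ∧ M + 2 ≤ (j : ℕ) + 1 then get1 w (2 * M + 2 - ((j : ℕ) + 1))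
    else if (i : ℕ) + 1 = M + 2 ∧ (j : ℕ) + 1 = M + 1 then -1
    else 0

/-- For a matrix with zero entries below the first subdiagonal and nonzero entries on it, the first
basis vector is cyclic: every basis vector is the image of it under a polynomial in the matrix. -/
theorem exists_aeval_mulVec_single_of_hessenberg {K : Type*} [Field K] {n : ℕ}
    (A : Matrix (Fin n) (Fin n) K) (hn : 0 < n)
    (hsub : ∀ i j : Fin n, (i : ℕ) = j + 1 → A i j ≠ 0)
    (hzero : ∀ i j : Fin n, (j : ℕ) + 1 < i → A i j = 0) (k : Fin n) :
    ∃ p : Polynomial K,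
      Polynomial.aeval A p *ᵥ Pi.single ⟨0, hn⟩ 1 = Pi.single k 1 := by
  let S : Submodule K (Fin n → K) :=
    { carrier := {x | ∃ p : Polynomial K, Polynomial.aeval A p *ᵥ Pi.single ⟨0, hn⟩ 1 = x}
      add_mem' := by
        rintro _ _ ⟨p, rfl⟩ ⟨q, rfl⟩
        exact ⟨p + q, by rw [map_add, add_mulVec]⟩
      zero_mem' := ⟨0, by rw [map_zero, zero_mulVec]⟩
      smul_mem' := by
        rintro c _ ⟨p, rfl⟩
        exact ⟨c • p, by rw [map_smul, smul_mulVec]⟩ }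
  have hS : ∀ x ∈ S, A *ᵥ x ∈ S := by
    rintro _ ⟨p, rfl⟩
    exact ⟨Polynomial.X * p, by rw [map_mul, Polynomial.aeval_X, mulVec_mulVec]⟩
  suffices ∀ (m : ℕ) (hm : m < n), Pi.single ⟨m, hm⟩ 1 ∈ S from this k k.2
  intro m
  induction m using Nat.strong_induction_on with
  | _ m ih =>
    intro hm
    rcases m with _ | m
    · exact ⟨1, by rw [map_one, one_mulVec]⟩
    · have hm' : m < n := by omega
      have hA := hS _ (ih m (by omega) hm')
      have hsplit : A *ᵥ Pi.single ⟨m, hm'⟩ 1 =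
          ∑ i, A i ⟨m, hm'⟩ • (Pi.single i 1 : Fin n → K) := by
        ext i
        simp [Finset.sum_apply, Pi.single_apply]
      rw [hsplit, ← Finset.add_sum_erase _ _ (Finset.mem_univ (⟨m + 1, hm⟩ : Fin n))] at hA
      refine (S.smul_mem_iff (hsub ⟨m + 1, hm⟩ ⟨m, hm'⟩ rfl)).1 ((S.add_mem_iff_left ?_).1 hA)
      refine S.sum_mem fun i hi => ?_
      rcases lt_or_ge (m + 1) (i : ℕ) with h | h
      · rw [hzero i _ h, zero_smul]
        exact S.zero_mem
      · have hne : (i : ℕ) ≠ m + 1 := fun h' => Finset.ne_of_mem_erase hi (Fin.ext h')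
        exact S.smul_mem _ (ih i (by omega) i.2)

/-- If `Aᵀ * B = B * A`, the same holds for every polynomial in `A`. -/
theorem transpose_aeval_mul_of_transpose_mul {R ι : Type*} [CommRing R] [Fintype ι]
    [DecidableEq ι] {A B : Matrix ι ι R} (h : Aᵀ * B = B * A) (p : Polynomial R) :
    (Polynomial.aeval A p)ᵀ * B = B * Polynomial.aeval A p := by
  induction p using Polynomial.induction_on' with
  | add p q hp hq => rw [map_add, transpose_add, add_mul, mul_add, hp, hq]
  | monomial n a =>
    have hpow : (Aᵀ) ^ n * B = B * A ^ n := (SemiconjBy.pow_right (a := B) h.symm n).symm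
    rw [Polynomial.aeval_monomial, ← Algebra.smul_def, transpose_smul, transpose_pow,
      Matrix.smul_mul, Matrix.mul_smul, hpow]

/-- If a basis vector is cyclic for `A`, the symmetric solutions of `Aᵀ * Θ = Θ * A` are
parametrized by their row at that index. -/
theorem existsUnique_isSymm_transpose_mul_of_cyclic {R ι : Type*} [CommRing R] [Fintype ι]
    [DecidableEq ι] (A : Matrix ι ι R) (i₀ : ι)
    (hcyc : ∀ k, ∃ p : Polynomial R, Polynomial.aeval A p *ᵥ Pi.single i₀ 1 = Pi.single k 1)
    (t : ι → R) :
    ∃! Θ : Matrix ι ι R, Θ.IsSymm ∧ (∀ j, Θ i₀ j = t j) ∧ Aᵀ * Θ = Θ * A := by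
  choose p hp using hcyc
  have hentry (B : Matrix ι ι R) (i j : ι) :
      B i j = Pi.single i 1 ⬝ᵥ B *ᵥ Pi.single j 1 := by simp
  have hcomm (q r : Polynomial R) : Polynomial.aeval A q * Polynomial.aeval A r =
      Polynomial.aeval A r * Polynomial.aeval A q := by
    rw [← map_mul, mul_comm, map_mul]
  have hswap (i j : ι) : Polynomial.aeval A (p i) *ᵥ Pi.single j 1 =
      Polynomial.aeval A (p j) *ᵥ Pi.single i 1 := by
    rw [← hp j, ← hp i, mulVec_mulVec, mulVec_mulVec, hcomm]
  have hAcomm (q : Polynomial R) : Polynomial.aeval A q * A = A * Polynomial.aeval A q := by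
    simpa using hcomm q Polynomial.X
  let Θ₀ : Matrix ι ι R := of fun i j => t ⬝ᵥ Polynomial.aeval A (p i) *ᵥ Pi.single j 1
  have hsymm : Θ₀.IsSymm := by
    ext i j
    simp only [Θ₀, transpose_apply, of_apply, hswap i j]
  have hmul (i j : ι) :
      (Θ₀ * A) i j = t ⬝ᵥ Polynomial.aeval A (p i) *ᵥ A *ᵥ Pi.single j 1 := by
    have hrow : Θ₀ i = t ᵥ* Polynomial.aeval A (p i) := by
      ext j
      simp only [Θ₀, of_apply, mulVec_single_one]
      rfl
    rw [mul_apply_eq_vecMul, hrow, vecMul_vecMul, mulVec_mulVec, dotProduct_mulVec]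
    simp
  refine ⟨Θ₀, ⟨hsymm, fun j => ?_, ?_⟩, fun Θ ⟨_, hrow, hΘ⟩ => ?_⟩
  · simp only [Θ₀, of_apply, hswap i₀ j, hp j]
    simp
  · have hT : Aᵀ * Θ₀ = (Θ₀ * A)ᵀ := by rw [transpose_mul, hsymm]
    ext i j
    rw [hT, transpose_apply, hmul, hmul, mulVec_mulVec, mulVec_mulVec, hAcomm, hAcomm,
      ← mulVec_mulVec, ← mulVec_mulVec, hswap i j]
  · ext i j
    have ht : Θ i₀ = t := funext hrow
    rw [hentry Θ, ← hp i, dotProduct_comm, ← dotProduct_transpose_mulVec, mulVec_mulVec,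
      transpose_aeval_mul_of_transpose_mul hΘ, ← mulVec_mulVec, dotProduct_comm]
    simp only [Θ₀, of_apply, ← ht, dotProduct_single_one]
    rfl

theorem Hhat_subdiagonal_eq (M : ℕ) (u : ℝ) (w : Fin M → ℝ) (i j : Fin (2 * M + 1))
    (h : (i : ℕ) = j + 1) : Hhat M u w i j = -1 := by
  simp only [Hhat, of_apply]
  split_ifs <;> first | rfl | omega

theorem Hhat_below_subdiagonal_eq (M : ℕ) (u : ℝ) (w : Fin M → ℝ) (i j : Fin (2 * M + 1))
    (h : (j : ℕ) + 1 < i) : Hhat M u w i j = 0 := by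
  simp only [Hhat, of_apply]
  split_ifs <;> first | rfl | omega

/-- for every `t ∈ ℝ^N` there is a unique real symmetric `N × N`
matrix `Θ` with first row `t` satisfying the Hermitization relation
`Ĥᵀ Θ = Θ Ĥ`; i.e. sending such `Θ` to its first row is a bijection onto `ℝ^N`. -/
theorem statement12 (M : ℕ) (hM : 1 ≤ M) (u : ℝ) (w : Fin M → ℝ)
    (t : Fin (2 * M + 1) → ℝ) :
    ∃! Θ : Matrix (Fin (2 * M + 1)) (Fin (2 * M + 1)) ℝ,
      Θ.IsSymm ∧ (∀ j : Fin (2 * M + 1), Θ ⟨0, by omega⟩ j = t j) ∧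
      (Hhat M u w)ᵀ * Θ = Θ * Hhat M u w := by
  exact existsUnique_isSymm_transpose_mul_of_cyclic (Hhat M u w) ⟨0, by omega⟩
    (exists_aeval_mulVec_single_of_hessenberg _ (by omega)
      (fun i j h => by rw [Hhat_subdiagonal_eq M u w i j h]; norm_num)
      (Hhat_below_subdiagonal_eq M u w)) t
end

section
/- Set f = (5 + √33)^{1/3} and s_EP = (2·√(6f² − 15f − f·√33 + 21 + 5·√33) − 2·√2·f) / (4·√(f·(f² − 2))) (numerically s_EP ≈ 0.5242106130). Then for every s ∈ ℝ, all five eigenvalues of the 5×5 matrix H(1/2, s) (equivalently, all five roots of ε⁵ + (2s² − 7/2)ε³ − 2sε² + (5/2 − 2s²)ε + 2s) are real if and only if |s| ≤ s_EP. -/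
open Matrix

/-- The 5×5 PT-symmetric Hamiltonian `H̃(r,s)` of Eq. (14) of the paper. -/
def Ham5 (r s : ℝ) : Matrix (Fin 5) (Fin 5) ℝ :=
  !![0, -1, r, 0, 0;
     -1, 0, -1 + s, 0, 0;
     -r, -1 - s, 0, -1 + s, r;
     0, 0, -1 - s, 0, -1;
     0, 0, -r, -1, 0]

/-- `f = (5 + √33)^(1/3)`. -/
noncomputable def fEP : ℝ := (5 + Real.sqrt 33) ^ ((1 : ℝ) / 3)

/-- The exceptional-point parameter value
`s_EP = (2 √(6f² − 15f − f√33 + 21 + 5√33) − 2√2 f) / (4 √(f(f² − 2)))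
      ≈ 0.5242106130`. -/
noncomputable def sEP : ℝ :=
  (2 * Real.sqrt (6 * fEP ^ 2 - 15 * fEP - fEP * Real.sqrt 33 + 21 + 5 * Real.sqrt 33)
      - 2 * Real.sqrt 2 * fEP) /
    (4 * Real.sqrt (fEP * (fEP ^ 2 - 2)))

theorem fEP_pos : 0 < fEP := by
  unfold fEP
  positivity

theorem fEP_cube : fEP ^ 3 = 5 + √33 := by
  unfold fEP
  rw [← Real.rpow_natCast, ← Real.rpow_mul (by positivity)]
  norm_num

theorem fEP_pow_six : fEP ^ 6 = 10 * fEP ^ 3 + 8 := by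
  have h : √(33 : ℝ) ^ 2 = 33 := Real.sq_sqrt (by norm_num)
  linear_combination (fEP ^ 3 + √33 - 5) * fEP_cube + h

theorem two_lt_fEP_sq : 2 < fEP ^ 2 := by
  have h : 2 < fEP := by
    refine lt_of_pow_lt_pow_left₀ 3 fEP_pos.le ?_
    have : (5 : ℝ) < √33 := Real.lt_sqrt_of_sq_lt (by norm_num)
    linarith [fEP_cube]
  nlinarith

theorem sEP_eq :
    sEP = √2 * (fEP ^ 2 - 2) ^ 2 / (4 * fEP * √(fEP * (fEP ^ 2 - 2))) := by
  have hf := fEP_pos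
  have h2 := two_lt_fEP_sq
  have hs : √(2 : ℝ) ^ 2 = 2 := Real.sq_sqrt (by norm_num)
  have hX : √(6 * fEP ^ 2 - 15 * fEP - fEP * √33 + 21 + 5 * √33)
      = √2 * (fEP ^ 4 - 2 * fEP ^ 2 + 4) / (2 * fEP) := by
    rw [Real.sqrt_eq_iff_mul_self_eq_of_pos]
    · have h33 : √(33 : ℝ) = fEP ^ 3 - 5 := by linarith [fEP_cube]
      rw [h33]
      field_simp
      rw [hs]
      linear_combination (2 * fEP ^ 2 - 4) * fEP_pow_six
    · have : 0 < fEP ^ 4 - 2 * fEP ^ 2 + 4 := by nlinarith [sq_nonneg (fEP ^ 2 - 1)]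
      positivity
  have hd : 0 < √(fEP * (fEP ^ 2 - 2)) := Real.sqrt_pos.2 (mul_pos hf (by linarith))
  unfold sEP
  rw [hX]
  field_simp
  ring

theorem sEP_nonneg : 0 ≤ sEP := by
  have := fEP_pos
  rw [sEP_eq]
  positivity

/-- `sEP ^ (2 / 3)` is the real root of `4 u ^ 3 + 6 u = 5`. -/
theorem sEP_sq : sEP ^ 2 = ((fEP ^ 2 - 2) / (2 * fEP)) ^ 3 := by
  have hf := fEP_pos
  have h2 : 0 < fEP ^ 2 - 2 := sub_pos.2 two_lt_fEP_sq
  rw [sEP_eq, div_pow, mul_pow, mul_pow _ (√_), Real.sq_sqrt zero_le_two,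
    Real.sq_sqrt (mul_pos hf h2).le]
  field_simp
  ring

theorem sEP_discrim_eq_zero : (5 / 2 - 2 * sEP ^ 2) ^ 3 = 27 * sEP ^ 2 := by
  have hf := fEP_pos
  have h : 5 / 2 - 2 * ((fEP ^ 2 - 2) / (2 * fEP)) ^ 3 = 3 * ((fEP ^ 2 - 2) / (2 * fEP)) := by
    field_simp
    linear_combination -fEP_pow_six
  rw [sEP_sq, h]
  ring

theorem abs_le_sEP_iff (s : ℝ) : |s| ≤ sEP ↔ 27 * s ^ 2 ≤ (5 / 2 - 2 * s ^ 2) ^ 3 := by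
  have h0 := sEP_discrim_eq_zero
  have hmono : Monotone fun x : ℝ => x ^ 3 := Odd.strictMono_pow (by decide) |>.monotone
  rw [← abs_of_nonneg sEP_nonneg, ← sq_le_sq]
  constructor
  · intro h
    have := hmono (show 5 / 2 - 2 * sEP ^ 2 ≤ 5 / 2 - 2 * s ^ 2 by linarith)
    simp only at this
    linarith
  · intro h
    by_contra! hlt
    have := hmono (show 5 / 2 - 2 * s ^ 2 ≤ 5 / 2 - 2 * sEP ^ 2 by linarith)
    simp only at this
    linarith

theorem exists_real_root_depressed_cubic (p q : ℝ) : ∃ w : ℝ, w ^ 3 + p * w + q = 0 := by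
  have hc : Continuous fun x : ℝ => x ^ 3 + p * x + q := by fun_prop
  have hp := abs_nonneg p
  have hq := abs_nonneg q
  obtain ⟨a, ha⟩ : ∃ a, a = 1 + |p| + |q| := ⟨_, rfl⟩
  have ha1 : 1 ≤ a := by linarith
  have hpa : |p| * a ≤ (a - 1 - |q|) * a := by
    gcongr
    linarith
  have hpa' : |p * a| ≤ a ^ 3 - |q| := by
    rw [abs_mul, abs_of_nonneg (by linarith : 0 ≤ a)]
    nlinarith [mul_nonneg hq (sub_nonneg.2 ha1), mul_nonneg (sq_nonneg a) (sub_nonneg.2 ha1)]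
  have hl := abs_le.1 hpa'
  have hl' := abs_le.1 (le_refl |q|)
  have hmem : (0 : ℝ) ∈ Set.Icc ((-a) ^ 3 + p * (-a) + q) (a ^ 3 + p * a + q) := by
    constructor <;> nlinarith
  obtain ⟨w, -, hw⟩ := intermediate_value_Icc (show -a ≤ a by linarith) hc.continuousOn hmem
  exact ⟨w, hw⟩

/-- A depressed real cubic has only real roots iff its discriminant is nonnegative. -/
theorem depressed_cubic_roots_real_iff (p q : ℝ) :
    (∀ z : ℂ, z ^ 3 + p * z + q = 0 → z.im = 0) ↔ 0 ≤ -4 * p ^ 3 - 27 * q ^ 2 := by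
  constructor
  · intro h
    by_contra! hd
    obtain ⟨w, hw⟩ := exists_real_root_depressed_cubic p q
    have hq : q = -(w ^ 3 + p * w) := by linarith
    have hpos : 0 < 3 * w ^ 2 + 4 * p := by
      by_contra! hle
      have := mul_nonneg (neg_nonneg.2 hle) (sq_nonneg (3 * w ^ 2 + p))
      subst hq
      nlinarith
    obtain ⟨y, hy0, hy⟩ : ∃ y : ℝ, 0 < y ∧ y ^ 2 = 3 * w ^ 2 + 4 * p :=
      ⟨_, Real.sqrt_pos.2 hpos, Real.sq_sqrt hpos.le⟩
    have him := h ⟨-w / 2, y / 2⟩ <| by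
      subst hq
      apply Complex.ext
      · simp [pow_succ]
        linear_combination (3 * w / 8) * hy
      · simp [pow_succ]
        linear_combination (-y / 8) * hy
    exact absurd him (div_pos hy0 two_pos).ne'
  · rintro hd ⟨x, y⟩ hz
    by_contra hy
    change y ≠ 0 at hy
    have hre := congrArg Complex.re hz
    have him := congrArg Complex.im hz
    simp [pow_succ] at hre him
    have hp : p = y ^ 2 - 3 * x ^ 2 := mul_left_cancel₀ hy (by linear_combination him)
    have hq : q = 2 * x * (x ^ 2 + y ^ 2) := by
      subst hp
      linear_combination hre
    have hneg : 0 < y ^ 2 * (9 * x ^ 2 + y ^ 2) ^ 2 := by positivity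
    subst hp hq
    nlinarith

theorem quintic_roots_real_iff (s : ℝ) :
    (∀ z : ℂ, z ^ 5 + (2 * (s : ℂ) ^ 2 - 7/2) * z ^ 3 - 2 * (s : ℂ) * z ^ 2 +
        (5/2 - 2 * (s : ℂ) ^ 2) * z + 2 * (s : ℂ) = 0 → z.im = 0) ↔ |s| ≤ sEP := by
  have hfac (z : ℂ) : z ^ 5 + (2 * (s : ℂ) ^ 2 - 7/2) * z ^ 3 - 2 * (s : ℂ) * z ^ 2 +
      (5/2 - 2 * (s : ℂ) ^ 2) * z + 2 * (s : ℂ) =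
      (z - 1) * (z + 1) *
        (z ^ 3 + ((2 * s ^ 2 - 5 / 2 : ℝ) : ℂ) * z + ((-2 * s : ℝ) : ℂ)) := by
    push_cast
    ring
  have hiff := depressed_cubic_roots_real_iff (2 * s ^ 2 - 5 / 2) (-2 * s)
  have hdisc : 0 ≤ -4 * (2 * s ^ 2 - 5 / 2) ^ 3 - 27 * (-2 * s) ^ 2 ↔ |s| ≤ sEP := by
    rw [abs_le_sEP_iff]
    constructor <;> intro h <;> linarith
  rw [← hdisc, ← hiff]
  refine ⟨fun h z hz => h z (by rw [hfac, hz, mul_zero]), fun h z hz => ?_⟩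
  rw [hfac, mul_eq_zero, mul_eq_zero] at hz
  rcases hz with (hz | hz) | hz
  · simp [sub_eq_zero.1 hz]
  · simp [eq_neg_of_add_eq_zero_left hz]
  · exact h z hz

theorem mem_spectrum_Ham5_half_iff (s : ℝ) (z : ℂ) :
    z ∈ spectrum ℂ ((Ham5 (1/2) s).map (Complex.ofReal)) ↔
      z ^ 5 + (2 * (s : ℂ) ^ 2 - 7/2) * z ^ 3 - 2 * (s : ℂ) * z ^ 2 +
        (5/2 - 2 * (s : ℂ) ^ 2) * z + 2 * (s : ℂ) = 0 := by
  rw [spectrum.mem_iff, Matrix.isUnit_iff_isUnit_det, isUnit_iff_ne_zero, not_not,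
    Matrix.algebraMap_eq_diagonal]
  refine Eq.congr_left ?_
  simp [Ham5, Matrix.det_succ_row_zero, Fin.sum_univ_succ, Fin.succAbove, Matrix.diagonal]
  ring

/-- for every `s ∈ ℝ`, all five eigenvalues of `H(1/2, s)`
(equivalently, all five complex roots of
`ε⁵ + (2s² − 7/2)ε³ − 2sε² + (5/2 − 2s²)ε + 2s`) are real iff `|s| ≤ s_EP`. -/
theorem statement14 (s : ℝ) :
    ((∀ z ∈ spectrum ℂ ((Ham5 (1/2) s).map (Complex.ofReal)), z.im = 0) ↔
      |s| ≤ sEP) ∧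
    ((∀ z : ℂ, z ^ 5 + (2 * (s : ℂ) ^ 2 - 7/2) * z ^ 3 - 2 * (s : ℂ) * z ^ 2 +
        (5/2 - 2 * (s : ℂ) ^ 2) * z + 2 * (s : ℂ) = 0 → z.im = 0) ↔
      |s| ≤ sEP) := by
  simp only [mem_spectrum_Ham5_half_iff, quintic_roots_real_iff, and_self]
end

section
/- At the interior parameter value s = 1/2, the matrix H(1/2, 1/2) has an exceptional-point degeneracy: ε = −1 is an eigenvalue of algebraic multiplicity 2 but geometric multiplicity 1. Concretely, the vector v = (0, 0, 0, 1, 1)ᵀ spans the full eigenspace of H(1/2, 1/2) for the eigenvalue −1, the vector (0, −1/2, −1, 0, 1/2)ᵀ is an associated (generalized) eigenvector satisfying (H(1/2,1/2) + I)·(0, −1/2, −1, 0, 1/2)ᵀ ∈ span{v} \ {0}, and consequently H(1/2, 1/2) is not diagonalizable over ℂ. -/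
open Matrix Polynomial

/-- Its complexification. -/
noncomputable def Ham5C : Matrix (Fin 5) (Fin 5) ℂ :=
  (Ham5 (1/2) (1/2)).map Complex.ofReal

theorem Ham5C_eq : Ham5C =
    !![0, -1, 1/2, 0, 0;
       -1, 0, -1/2, 0, 0;
       -1/2, -3/2, 0, -1/2, 1/2;
       0, 0, -3/2, 0, -1;
       0, 0, -1/2, -1, 0] := by
  ext i j
  fin_cases i <;> fin_cases j <;> simp [Ham5C, Ham5] <;> norm_num

theorem charpoly_Ham5C :
    Ham5C.charpoly = (X ^ 3 - 2 * X ^ 2 + 1) * (X - C (-1)) ^ 2 := by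
  refine Polynomial.funext fun t => ?_
  rw [Matrix.eval_charpoly, Ham5C_eq]
  simp [Matrix.det_succ_row_zero, Fin.sum_univ_succ, Fin.succAbove]
  ring

theorem rootMultiplicity_charpoly_Ham5C :
    Ham5C.charpoly.rootMultiplicity (-1) = 2 := by
  have hroot : ¬ IsRoot (X ^ 3 - 2 * X ^ 2 + 1 : ℂ[X]) (-1) := by
    norm_num [IsRoot.def]
  have hne : (X ^ 3 - 2 * X ^ 2 + 1 : ℂ[X]) ≠ 0 := by
    intro h
    simp [h] at hroot
  rw [charpoly_Ham5C, rootMultiplicity_mul_X_sub_C_pow hne, rootMultiplicity_eq_zero hroot]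

theorem Ham5C_mulVec_eq_neg_iff (x : Fin 5 → ℂ) :
    Ham5C.mulVec x = (-1 : ℂ) • x ↔ ∃ c : ℂ, x = c • ![0, 0, 0, 1, 1] := by
  constructor
  · intro h
    rw [Ham5C_eq] at h
    have h0 := congrFun h 0
    have h1 := congrFun h 1
    have h2 := congrFun h 2
    have h3 := congrFun h 3
    have h4 := congrFun h 4
    simp [Matrix.mulVec, dotProduct, Fin.sum_univ_succ] at h0 h1 h2 h3 h4
    refine ⟨x 3, ?_⟩
    ext i
    fin_cases i <;> simp <;> grind
  · rintro ⟨c, rfl⟩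
    rw [Ham5C_eq]
    ext i
    fin_cases i <;> simp [Matrix.mulVec, dotProduct, Fin.sum_univ_succ]
    ring

theorem Ham5C_add_one_mulVec :
    (Ham5C + 1).mulVec ![0, -1/2, -1, 0, 1/2] = ![0, 0, 0, 1, 1] := by
  rw [Matrix.add_mulVec, Matrix.one_mulVec, Ham5C_eq]
  ext i
  fin_cases i <;> simp <;> norm_num

/-- A diagonalizable matrix over a field has no generalized eigenvectors of rank two. -/
theorem Matrix.mulVec_eq_zero_of_mulVec_mulVec_eq_zero {n K : Type*} [Fintype n] [DecidableEq n]
    [Field K] {A P D : Matrix n n K} (hP : IsUnit P) (hD : D.IsDiag) (hA : A = P * D * P⁻¹)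
    (a : K) {w : n → K} (hw : (A + a • 1).mulVec ((A + a • 1).mulVec w) = 0) :
    (A + a • 1).mulVec w = 0 := by
  have hdet := (Matrix.isUnit_iff_isUnit_det P).mp hP
  obtain ⟨d, rfl⟩ : ∃ d, D = diagonal d := ⟨_, hD.diagonal_diag.symm⟩
  have hconj : A + a • 1 = P * diagonal (fun i => d i + a) * P⁻¹ := by
    have : diagonal (fun i => d i + a) = diagonal d + a • (1 : Matrix n n K) := by
      rw [Matrix.smul_one_eq_diagonal, Matrix.diagonal_add]
    rw [this, hA, mul_add, add_mul, mul_smul_comm, mul_one, smul_mul_assoc,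
      Matrix.mul_nonsing_inv P hdet]
  rw [hconj] at hw ⊢
  simp only [← Matrix.mulVec_mulVec] at hw ⊢
  rw [Matrix.mulVec_mulVec _ P⁻¹ P, Matrix.nonsing_inv_mul P hdet, Matrix.one_mulVec] at hw
  have hinj := Matrix.mulVec_injective_of_isUnit hP
  have hz := hinj (hw.trans (Matrix.mulVec_zero P).symm)
  rw [show (diagonal fun i => d i + a).mulVec (P⁻¹.mulVec w) = 0 from ?_, Matrix.mulVec_zero]
  ext i
  have := congrFun hz i
  simp only [Matrix.mulVec_diagonal, Pi.zero_apply, mul_eq_zero] at this ⊢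
  tauto

/-- at `s = 1/2` the matrix `H(1/2, 1/2)` has an exceptional-point
degeneracy at `ε = −1`: algebraic multiplicity `2`, geometric multiplicity `1`
(the eigenspace is spanned by `v = (0,0,0,1,1)ᵀ`), the vector
`(0, −1/2, −1, 0, 1/2)ᵀ` is an associated (generalized) eigenvector with
`(H + I)·(0,−1/2,−1,0,1/2)ᵀ ∈ span{v} \ {0}`, and consequently `H(1/2, 1/2)` is
not diagonalizable over `ℂ`. -/
theorem statement15 :
    (Ham5C.charpoly).rootMultiplicity (-1) = 2 ∧
    (∀ x : Fin 5 → ℂ,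
      Ham5C.mulVec x = (-1 : ℂ) • x ↔ ∃ c : ℂ, x = c • ![0, 0, 0, 1, 1]) ∧
    (∃ c : ℂ, c ≠ 0 ∧
      (Ham5C + 1).mulVec ![0, -1/2, -1, 0, 1/2] = c • ![0, 0, 0, 1, 1]) ∧
    ¬ ∃ (P D : Matrix (Fin 5) (Fin 5) ℂ), IsUnit P ∧ D.IsDiag ∧
        Ham5C = P * D * P⁻¹ := by
  refine ⟨rootMultiplicity_charpoly_Ham5C, Ham5C_mulVec_eq_neg_iff,
    ⟨1, one_ne_zero, by rw [Ham5C_add_one_mulVec, one_smul]⟩, ?_⟩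
  rintro ⟨P, D, hP, hD, hA⟩
  have hv : (Ham5C + 1).mulVec ![0, 0, 0, 1, 1] = 0 := by
    rw [Matrix.add_mulVec, Matrix.one_mulVec,
      (Ham5C_mulVec_eq_neg_iff _).mpr ⟨1, (one_smul ℂ _).symm⟩, neg_one_smul, neg_add_cancel]
  have h := Matrix.mulVec_eq_zero_of_mulVec_mulVec_eq_zero hP hD hA 1
    (w := ![0, -1/2, -1, 0, 1/2]) (by rw [one_smul, Ham5C_add_one_mulVec, hv])
  rw [one_smul, Ham5C_add_one_mulVec] at h
  simpa using congrFun h 3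
end

section
/- There exists δ > 0 such that for every ξ ∈ ℝ with |ξ| < δ, the matrix Θ(ξ) is positive definite; i.e., there is a nonempty open interval of parameters ξ around 0 on which the one-parameter family Θ(ξ) of Hermitizing metric candidates for the maximally asymmetric 5×5 Hamiltonian remains a genuine (positive-definite) metric. -/
open Matrix

/-- The one-parameter family `Θ(ξ)` of sparse-ansatz Hermitizing metric
candidates (Eq. (20) of the paper). -/
noncomputable def Theta (ξ : ℝ) : Matrix (Fin 5) (Fin 5) ℝ :=
  !![1, 0, ξ, 0, 0;
     0, 1 + ξ, -1/2, ξ, -ξ/2;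
     ξ, -1/2, 1 + ξ, -1/2 - ξ/2, 1/4 + ξ;
     0, ξ, -1/2 - ξ/2, 5/4 + ξ, -1 - ξ/2;
     0, -ξ/2, 1/4 + ξ, -1 - ξ/2, 5/4 + ξ/4]

theorem dotProduct_Theta_mulVec (ξ : ℝ) (x : Fin 5 → ℝ) :
    x ⬝ᵥ (Theta ξ *ᵥ x) =
      x 0 ^ 2 + x 1 ^ 2 + x 2 ^ 2 + 5 / 4 * x 3 ^ 2 + 5 / 4 * x 4 ^ 2 - x 1 * x 2 - x 2 * x 3
        + x 2 * x 4 / 2 - 2 * x 3 * x 4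
      + ξ * (x 1 ^ 2 + x 2 ^ 2 + x 3 ^ 2 + x 4 ^ 2 / 4 + 2 * x 0 * x 2 + 2 * x 1 * x 3
        - x 1 * x 4 - x 2 * x 3 + 2 * x 2 * x 4 - x 3 * x 4) := by
  simp [Theta, dotProduct, mulVec, Fin.sum_univ_five]
  ring

theorem Theta_zero_form_lower_bound (a b c d e : ℝ) :
    (a ^ 2 + b ^ 2 + c ^ 2 + d ^ 2 + e ^ 2) / 20 ≤
      a ^ 2 + b ^ 2 + c ^ 2 + 5 / 4 * d ^ 2 + 5 / 4 * e ^ 2 - b * c - c * d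
        + c * e / 2 - 2 * d * e := by
  linarith [sq_nonneg a, sq_nonneg (b - 10 / 19 * c), sq_nonneg (c - 190 / 261 * d + 95 / 261 * e),
    sq_nonneg (d - 2135 / 2182 * e), sq_nonneg e]

theorem Theta_linear_form_abs_le (a b c d e : ℝ) :
    |b ^ 2 + c ^ 2 + d ^ 2 + e ^ 2 / 4 + 2 * a * c + 2 * b * d - b * e - c * d
        + 2 * c * e - d * e| ≤ 4 * (a ^ 2 + b ^ 2 + c ^ 2 + d ^ 2 + e ^ 2) := by
  rw [abs_le]
  constructor <;>
  linarith [sq_nonneg (a + c), sq_nonneg (a - c), sq_nonneg (b + d), sq_nonneg (b - d),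
    sq_nonneg (b + e), sq_nonneg (b - e), sq_nonneg (c + d), sq_nonneg (c - d),
    sq_nonneg (c + e), sq_nonneg (c - e), sq_nonneg (d + e), sq_nonneg (d - e),
    sq_nonneg a, sq_nonneg b, sq_nonneg c, sq_nonneg d, sq_nonneg e]

/-- there is `δ > 0` such that `Θ(ξ)` is positive definite for
every `ξ` with `|ξ| < δ`: the one-parameter family of Hermitizing metric
candidates remains a genuine (positive-definite) metric on a nonempty open
interval around `ξ = 0`. -/
theorem statement18 :
    ∃ δ : ℝ, 0 < δ ∧ ∀ ξ : ℝ, |ξ| < δ → (Theta ξ).PosDef := by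
  refine ⟨1 / 100, by norm_num, fun ξ hξ ↦ .of_dotProduct_mulVec_pos ?_ fun x hx ↦ ?_⟩
  · ext i j
    fin_cases i <;> fin_cases j <;> simp [Theta]
  · rw [star_trivial, dotProduct_Theta_mulVec]
    have hpos : 0 < x 0 ^ 2 + x 1 ^ 2 + x 2 ^ 2 + x 3 ^ 2 + x 4 ^ 2 := by
      have h := dotProduct_star_self_pos_iff.mpr hx
      simp only [star_trivial, dotProduct, Fin.sum_univ_five] at h
      linarith
    have h₀ := Theta_zero_form_lower_bound (x 0) (x 1) (x 2) (x 3) (x 4)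
    have h₁ := mul_le_mul hξ.le
      (Theta_linear_form_abs_le (x 0) (x 1) (x 2) (x 3) (x 4)) (abs_nonneg _) (by norm_num)
    rw [← abs_mul] at h₁
    linarith [(abs_le.mp h₁).1]
end
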